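/- arXiv:1101.5767 — 3 statements merged into one kernel-verified Lean document; each statement's English description precedes it below -/
import Mathlib

section
/- Let m, n ≥ 1 and k ≥ 1 with m + n + k ≤ g. Let p_1, …, p_m ∈ H satisfy gcd(p_1,…,p_m) = 1, let D_1 be a dual summand for p_1,…,p_m with basis q_1,…,q_m, and set S_1 = span_ℤ(p_1,…,p_m) and T_1 = (S_1 + D_1)^⊥. Let v_1, …, v_n ∈ H satisfy gcd(v_1,…,v_n) = 1, set S_2 = span_ℤ(v_1,…,v_n), and let D_2 ⊆ T_1 be a dual summand for v_1,…,v_n contained in T_1. Let w_1, …, w_k ∈ H be given with gcd(w_1,…,w_k,p_1,…,p_m,q_1,…,q_m,v_1,…,v_n) = 1. Then there exists an isotropic direct summand D_3 ⊆ T_1 of rank n + k which is a dual summand for the family (v_1,…,v_n,w_1,…,w_k), and such that S_2 + D_2 ⊆ S_1 + D_1 + span_ℤ(v_1,…,v_n,w_1,…,w_k) + D_3. -/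
namespace Paper

/-- The standard symplectic form on `R^{2g}` with respect to the basis
`a_1, b_1, …, a_g, b_g` (coordinates `2i, 2i+1` for `a_{i+1}, b_{i+1}`). -/
def symp {R : Type*} [CommRing R] {g : ℕ} (x y : Fin (2 * g) → R) : R :=
  ∑ i : Fin g,
    (x ⟨2 * i.1, by omega⟩ * y ⟨2 * i.1 + 1, by omega⟩ -
      x ⟨2 * i.1 + 1, by omega⟩ * y ⟨2 * i.1, by omega⟩)

theorem symp_add_left {R : Type*} [CommRing R] {g : ℕ} (x y a : Fin (2 * g) → R) :
    symp (x + y) a = symp x a + symp y a := by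
  unfold symp
  rw [← Finset.sum_add_distrib]
  exact Finset.sum_congr rfl fun i _ => by simp only [Pi.add_apply]; ring

theorem symp_smul_left {R : Type*} [CommRing R] {g : ℕ} (c : R) (x a : Fin (2 * g) → R) :
    symp (c • x) a = c * symp x a := by
  unfold symp
  rw [Finset.mul_sum]
  exact Finset.sum_congr rfl fun i _ => by simp only [Pi.smul_apply, smul_eq_mul]; ring

theorem symp_zero_left {R : Type*} [CommRing R] {g : ℕ} (a : Fin (2 * g) → R) :
    symp (0 : Fin (2 * g) → R) a = 0 := by
  unfold symp; simp

/-- The orthogonal complement `A^⊥ = {x | ω(x,a) = 0 for all a ∈ A}`. -/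
def perp {R : Type*} [CommRing R] {g : ℕ} (A : Set (Fin (2 * g) → R)) :
    Submodule R (Fin (2 * g) → R) where
  carrier := {x | ∀ a ∈ A, symp x a = 0}
  add_mem' := by
    intro x y hx hy a ha
    rw [symp_add_left, hx a ha, hy a ha, add_zero]
  zero_mem' := by
    intro a ha
    exact symp_zero_left a
  smul_mem' := by
    intro c x hx a ha
    rw [symp_smul_left, hx a ha, mul_zero]

/-- The submodule of vectors whose first `m` coordinates vanish.
`H_k = coordZero R (2*g) (2*(k-1))`, and `H₂ = coordZero R (2*(g+1)) 2`. -/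
def coordZero (R : Type*) [CommRing R] (n m : ℕ) : Submodule R (Fin n → R) where
  carrier := {v | ∀ j : Fin n, (j : ℕ) < m → v j = 0}
  add_mem' := by
    intro x y hx hy j hj
    have h1 := hx j hj
    have h2 := hy j hj
    simp [Pi.add_apply, h1, h2]
  zero_mem' := by intro j hj; rfl
  smul_mem' := by
    intro c x hx j hj
    have h1 := hx j hj
    simp [Pi.smul_apply, h1]

/-- The standard basis vector `a_{i+1}` (`i` is 0-indexed). -/
def stdA (R : Type*) [CommRing R] (g i : ℕ) : Fin (2 * g) → R :=
  fun j => if (j : ℕ) = 2 * i then 1 else 0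

/-- The standard basis vector `b_{i+1}` (`i` is 0-indexed). -/
def stdB (R : Type*) [CommRing R] (g i : ℕ) : Fin (2 * g) → R :=
  fun j => if (j : ℕ) = 2 * i + 1 then 1 else 0

/-- Regard an integer vector as a rational vector. -/
def qcast {n : ℕ} (v : Fin n → ℤ) : Fin n → ℚ := fun j => (v j : ℚ)

/-- The projection `pr₂` deleting the `a_1`- and `b_1`-coordinates. -/
def pr2 {R : Type*} [CommRing R] {n : ℕ} (v : Fin n → R) : Fin n → R :=
  fun j => if (j : ℕ) < 2 then 0 else v j

/-- `gcd(v_1, …, v_m) = 1`: the vectors are linearly independent and their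
ℤ-span is a direct summand. -/
def IsUnimodular {n m : ℕ} (v : Fin m → Fin n → ℤ) : Prop :=
  LinearIndependent ℤ v ∧
    ∃ C : Submodule ℤ (Fin n → ℤ), IsCompl (Submodule.span ℤ (Set.range v)) C

/-- A primitive vector. -/
def Primitive {n : ℕ} (v : Fin n → ℤ) : Prop := IsUnimodular ![v]

/-- The entries of `w` are pairwise `ω`-orthogonal. -/
def PairwiseOrth {g m : ℕ} (w : Fin m → Fin (2 * g) → ℤ) : Prop :=
  ∀ i j, i ≠ j → symp (w i) (w j) = 0

/-- `Λ³ W`: the span of all wedges of three vectors from `W` inside the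
exterior algebra. -/
def wedge3 {g : ℕ} (W : Submodule ℚ (Fin (2 * g) → ℚ)) :
    Submodule ℚ (ExteriorAlgebra ℚ (Fin (2 * g) → ℚ)) :=
  Submodule.span ℚ {x | ∃ z₁ ∈ W, ∃ z₂ ∈ W, ∃ z₃ ∈ W,
    x = ExteriorAlgebra.ι ℚ z₁ * ExteriorAlgebra.ι ℚ z₂ * ExteriorAlgebra.ι ℚ z₃}

/-- `u ∧ Λ² W`. -/
def uWedge2 {g : ℕ} (u : Fin (2 * g) → ℚ) (W : Submodule ℚ (Fin (2 * g) → ℚ)) :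
    Submodule ℚ (ExteriorAlgebra ℚ (Fin (2 * g) → ℚ)) :=
  Submodule.span ℚ {x | ∃ z₁ ∈ W, ∃ z₂ ∈ W,
    x = ExteriorAlgebra.ι ℚ u * ExteriorAlgebra.ι ℚ z₁ * ExteriorAlgebra.ι ℚ z₂}

/-- `u ∧ u' ∧ W`. -/
def uuWedge1 {g : ℕ} (u u' : Fin (2 * g) → ℚ) (W : Submodule ℚ (Fin (2 * g) → ℚ)) :
    Submodule ℚ (ExteriorAlgebra ℚ (Fin (2 * g) → ℚ)) :=
  Submodule.span ℚ {x | ∃ z ∈ W,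
    x = ExteriorAlgebra.ι ℚ u * ExteriorAlgebra.ι ℚ u' * ExteriorAlgebra.ι ℚ z}

/-- The simplicial differential: on the summand indexed by `w` it sends `z` to
`Σ_j (-1)^j · z` placed in the summand indexed by `∂_j w`. -/
noncomputable def diff (g p : ℕ)
    (ξ : (Fin (p + 1) → Fin (2 * g) → ℤ) →₀ ExteriorAlgebra ℚ (Fin (2 * g) → ℚ)) :
    (Fin p → Fin (2 * g) → ℤ) →₀ ExteriorAlgebra ℚ (Fin (2 * g) → ℚ) :=
  ξ.sum fun w z =>
    ∑ j : Fin (p + 1), ((-1 : ℚ) ^ (j : ℕ)) • Finsupp.single (fun i => w (j.succAbove i)) z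

/-- The gcd of the determinants of all maximal square submatrices of the matrix
whose columns are the `v i`. -/
def vgcd {ι : Type*} [Fintype ι] {m : ℕ} (v : Fin m → ι → ℤ) : ℕ :=
  Finset.univ.gcd fun r : Fin m → ι => (Matrix.det (Matrix.of fun i j => v j (r i))).natAbs

section Alternating

variable {M ι : Type*} [AddCommGroup M] [DecidableEq ι] {B : M →ₗ[ℤ] M →ₗ[ℤ] ℤ}

/-- Orthogonal projection away from the span of a family `P` and an isotropic dual family `Q`. -/
theorem exists_sub_orthogonal (hB : B.IsAlt) (s : Finset ι) (P Q : ι → M)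
    (hQ : ∀ i ∈ s, ∀ j ∈ s, B (Q i) (Q j) = 0)
    (hPQ : ∀ i ∈ s, ∀ j ∈ s, B (P i) (Q j) = if i = j then 1 else 0) (x : M) :
    ∃ a c : ι → ℤ, ∀ j ∈ s,
      B (x - ∑ i ∈ s, a i • P i - ∑ i ∈ s, c i • Q i) (P j) = 0 ∧
      B (x - ∑ i ∈ s, a i • P i - ∑ i ∈ s, c i • Q i) (Q j) = 0 := by
  have hQP : ∀ i ∈ s, ∀ j ∈ s, B (Q i) (P j) = if i = j then -1 else 0 := by
    intro i hi j hj
    rw [← hB.neg, hPQ j hj i hi]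
    by_cases h : i = j <;> simp [h, eq_comm]
  refine ⟨fun i => B x (Q i),
    fun j => B (∑ i ∈ s, B x (Q i) • P i) (P j) - B x (P j), fun j hj => ⟨?_, ?_⟩⟩
  · have h : ∑ i ∈ s, (B (∑ i ∈ s, B x (Q i) • P i) (P i) - B x (P i)) * B (Q i) (P j) =
        -(B (∑ i ∈ s, B x (Q i) • P i) (P j) - B x (P j)) := by
      rw [Finset.sum_congr rfl fun i hi => by rw [hQP i hi j hj]]
      simp [hj]
    rw [map_sub, map_sub, LinearMap.sub_apply, LinearMap.sub_apply,
      map_sum B (fun i => _ • Q i), LinearMap.sum_apply]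
    simp only [map_smul B, LinearMap.smul_apply, smul_eq_mul]
    rw [h]
    ring
  · have h1 : ∑ i ∈ s, B x (Q i) * B (P i) (Q j) = B x (Q j) := by
      rw [Finset.sum_congr rfl fun i hi => by rw [hPQ i hi j hj]]
      simp [hj]
    have h2 : ∀ c : ι → ℤ, ∑ i ∈ s, c i * B (Q i) (Q j) = 0 := fun c =>
      Finset.sum_eq_zero fun i hi => by rw [hQ i hi j hj, mul_zero]
    rw [map_sub, map_sub, LinearMap.sub_apply, LinearMap.sub_apply,
      map_sum B (fun i => _ • Q i), map_sum B (fun i => _ • P i), LinearMap.sum_apply,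
      LinearMap.sum_apply]
    simp only [map_smul B, LinearMap.smul_apply, smul_eq_mul]
    rw [h1, h2]
    ring

/-- `u` is an isotropic family, dual to `f`, on the index set `s`. -/
def IsDualOn (B : M →ₗ[ℤ] M →ₗ[ℤ] ℤ) (s : Finset ι) (f u : ι → M) : Prop :=
  (∀ i ∈ s, ∀ j ∈ s, B (u i) (u j) = 0) ∧
    ∀ i ∈ s, ∀ j ∈ s, B (f i) (u j) = if i = j then 1 else 0

/-- Every vector orthogonal to `f` and `u` on `s` is a multiple of the first vector of a
hyperbolic pair orthogonal to `f` and `u`. -/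
def HasHyperbolicPairs (B : M →ₗ[ℤ] M →ₗ[ℤ] ℤ) (s : Finset ι) (f u : ι → M) : Prop :=
  ∀ t, (∀ i ∈ s, B t (f i) = 0 ∧ B t (u i) = 0) →
    ∃ (b : ℤ) (x y : M), t = b • x ∧ B x y = 1 ∧
      (∀ i ∈ s, B x (f i) = 0 ∧ B x (u i) = 0) ∧ ∀ i ∈ s, B y (f i) = 0 ∧ B y (u i) = 0

theorem IsDualOn.exists_insert (hB : B.IsAlt) {s : Finset ι} {f u : ι → M}
    (hd : IsDualOn B s f u) (hpair : HasHyperbolicPairs B s f u) {a : ι} (ha : a ∉ s)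
    (φ : M →ₗ[ℤ] ℤ) (hφa : φ (f a) = 1) (hφ : ∀ i ∈ s, φ (f i) = 0) :
    ∃ u' : ι → M, IsDualOn B (insert a s) f u' ∧
      ∀ i ∈ s, u i ∈ Submodule.span ℤ (f '' ↑(insert a s)) ⊔
        Submodule.span ℤ (u' '' ↑(insert a s)) := by
  obtain ⟨huu, hfu⟩ := hd
  obtain ⟨A, c, ht⟩ := exists_sub_orthogonal hB s f u huu hfu (f a)
  obtain ⟨b, x, y, hbx, hxy, hx, hy⟩ := hpair _ ht
  have huf : ∀ i ∈ s, ∀ j ∈ s, B (u i) (f j) = if i = j then -1 else 0 := by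
    intro i hi j hj
    rw [← hB.neg, hfu j hj i hi]
    by_cases h : i = j <;> simp [h, eq_comm]
  have hfa : f a = ∑ i ∈ s, A i • f i + ∑ i ∈ s, c i • u i + b • x := by
    rw [← hbx]; abel
  have hbez : ∑ i ∈ s, c i * φ (u i) + b * φ x = 1 := by
    have h := hφa
    rw [hfa, map_add, map_add, map_sum, map_sum] at h
    simp only [map_smul, smul_eq_mul] at h
    rwa [Finset.sum_eq_zero (s := s) (f := fun i => A i * φ (f i))
      fun i hi => by rw [hφ i hi, mul_zero], zero_add] at h
  set X := ∑ i ∈ s, φ (u i) • f i with hX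
  have hXu : ∀ j ∈ s, B X (u j) = φ (u j) := by
    intro j hj
    rw [hX, map_sum, LinearMap.sum_apply]
    simp only [map_smul B, LinearMap.smul_apply, smul_eq_mul]
    rw [Finset.sum_congr rfl fun i hi => by rw [hfu i hi j hj]]
    simp [hj]
  have hXy : B X y = 0 := by
    rw [← hB.neg, hX, map_sum, Finset.sum_eq_zero, neg_zero]
    intro i hi
    rw [map_smul, (hy i hi).1, smul_zero]
  have hXx : B X x = 0 := by
    rw [← hB.neg, hX, map_sum, Finset.sum_eq_zero, neg_zero]
    intro i hi
    rw [map_smul, (hx i hi).1, smul_zero]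
  set Y := ∑ i ∈ s, B X (f i) • u i with hY
  have hBY : ∀ z, B Y z = ∑ i ∈ s, B X (f i) * B (u i) z := by
    intro z
    rw [hY, map_sum, LinearMap.sum_apply]
    simp only [map_smul B, LinearMap.smul_apply, smul_eq_mul]
  have hYf : ∀ j ∈ s, B Y (f j) = - B X (f j) := by
    intro j hj
    rw [hBY, Finset.sum_congr rfl fun i hi => by rw [huf i hi j hj]]
    simp [hj]
  have hYu : ∀ j ∈ s, B Y (u j) = 0 := by
    intro j hj
    rw [hBY]
    exact Finset.sum_eq_zero fun i hi => by rw [huu i hi j hj, mul_zero]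
  have hux : ∀ j ∈ s, B (u j) x = 0 := fun j hj => by rw [← hB.neg, (hx j hj).2, neg_zero]
  have huy : ∀ j ∈ s, B (u j) y = 0 := fun j hj => by rw [← hB.neg, (hy j hj).2, neg_zero]
  have hfy : ∀ j ∈ s, B (f j) y = 0 := fun j hj => by rw [← hB.neg, (hy j hj).1, neg_zero]
  have hYx : B Y x = 0 := by
    rw [hBY]
    exact Finset.sum_eq_zero fun i hi => by rw [hux i hi, mul_zero]
  have hYy : B Y y = 0 := by
    rw [hBY]
    exact Finset.sum_eq_zero fun i hi => by rw [huy i hi, mul_zero]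
  set e := x + φ x • y - X - Y with he
  have hef : ∀ j ∈ s, B e (f j) = 0 := by
    intro j hj
    simp only [he, map_sub, map_add, map_smul, LinearMap.sub_apply, LinearMap.add_apply,
      LinearMap.smul_apply, smul_eq_mul, (hx j hj).1, (hy j hj).1, hYf j hj]
    ring
  have heu : ∀ j ∈ s, B e (u j) = - φ (u j) := by
    intro j hj
    simp only [he, map_sub, map_add, map_smul, LinearMap.sub_apply, LinearMap.add_apply,
      LinearMap.smul_apply, smul_eq_mul, (hx j hj).2, (hy j hj).2, hYu j hj, hXu j hj]
    ring
  have hey : B e y = 1 := by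
    simp only [he, map_sub, map_add, map_smul, LinearMap.sub_apply, LinearMap.add_apply,
      LinearMap.smul_apply, smul_eq_mul, hxy, hB.self_eq_zero, hXy, hYy]
    ring
  have hex : B e x = - φ x := by
    have hyx : B y x = -1 := by rw [← hB.neg, hxy]
    simp only [he, map_sub, map_add, map_smul, LinearMap.sub_apply, LinearMap.add_apply,
      LinearMap.smul_apply, smul_eq_mul, hyx, hB.self_eq_zero, hXx, hYx]
    ring
  have hefa : B e (f a) = -1 := by
    rw [hfa, map_add, map_add, map_sum, map_sum]
    simp only [map_smul, smul_eq_mul, hex]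
    have h1 : ∑ i ∈ s, A i * B e (f i) = 0 :=
      Finset.sum_eq_zero fun i hi => by rw [hef i hi, mul_zero]
    have h2 : ∑ i ∈ s, c i * B e (u i) = -∑ i ∈ s, c i * φ (u i) := by
      rw [← Finset.sum_neg_distrib]
      exact Finset.sum_congr rfl fun i hi => by rw [heu i hi, mul_neg]
    rw [h1, h2]
    linarith
  have hae : B (f a) e = 1 := by rw [← hB.neg, hefa, neg_neg]
  set U : ι → M := fun i => u i + φ (u i) • y with hU
  have heU : ∀ j ∈ s, B e (U j) = 0 := by
    intro j hj
    simp only [hU, map_add, map_smul, heu j hj, hey, smul_eq_mul]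
    ring
  have hUe : ∀ j ∈ s, B (U j) e = 0 := fun j hj => by rw [← hB.neg, heU j hj, neg_zero]
  have hUU : ∀ i ∈ s, ∀ j ∈ s, B (U i) (U j) = 0 := by
    intro i hi j hj
    simp [hU, huu i hi j hj, huy i hi, (hy j hj).2, hB.self_eq_zero]
  have hfU : ∀ i ∈ s, ∀ j ∈ s, B (f i) (U j) = if i = j then 1 else 0 := by
    intro i hi j hj
    simp [hU, hfu i hi j hj, hfy i hi]
  have hfe : ∀ j ∈ s, B (f j) e = 0 := fun j hj => by rw [← hB.neg, hef j hj, neg_zero]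
  set u' : ι → M := fun i => if i = a then e else U i - B (f a) (U i) • e with hu'
  have hu'a : u' a = e := by simp [hu']
  have hu's : ∀ i ∈ s, u' i = U i - B (f a) (U i) • e := by
    intro i hi
    have : i ≠ a := fun h => ha (h ▸ hi)
    simp [hu', this]
  refine ⟨u', ⟨?_, ?_⟩, ?_⟩
  · intro i hi j hj
    rcases Finset.mem_insert.1 hi with rfl | his <;> rcases Finset.mem_insert.1 hj with hja | hjs
    · rw [hja, hB.self_eq_zero]
    · simp [hu'a, hu's j hjs, heU j hjs, hB.self_eq_zero]
    · simp [hja, hu'a, hu's i his, hUe i his, hB.self_eq_zero]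
    · simp [hu's i his, hu's j hjs, hUe i his, heU j hjs, hUU i his j hjs, hB.self_eq_zero]
  · intro i hi j hj
    rcases Finset.mem_insert.1 hi with rfl | his <;> rcases Finset.mem_insert.1 hj with hja | hjs
    · simp [hja, hu'a, hae]
    · have : i ≠ j := fun h => ha (h ▸ hjs)
      simp [hu's j hjs, hae, this]
    · have : i ≠ a := fun h => ha (h ▸ his)
      simp [hja, hu'a, hfe i his, this]
    · simp [hu's j hjs, hfU i his j hjs, hfe i his]
  · set N := Submodule.span ℤ (f '' ↑(insert a s)) ⊔ Submodule.span ℤ (u' '' ↑(insert a s))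
    have hfN : ∀ i ∈ insert a s, f i ∈ N := fun i hi =>
      Submodule.mem_sup_left (Submodule.subset_span ⟨i, hi, rfl⟩)
    have hu'N : ∀ i ∈ insert a s, u' i ∈ N := fun i hi =>
      Submodule.mem_sup_right (Submodule.subset_span ⟨i, hi, rfl⟩)
    have heN : e ∈ N := hu'a ▸ hu'N a (Finset.mem_insert_self _ _)
    have hUN : ∀ i ∈ s, U i ∈ N := by
      intro i hi
      have h := N.add_mem (hu'N i (Finset.mem_insert_of_mem hi)) (N.smul_mem (B (f a) (U i)) heN)
      rwa [hu's i hi, sub_add_cancel] at h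
    have hsumf : ∀ r : ι → ℤ, ∑ i ∈ s, r i • f i ∈ N := fun r =>
      N.sum_mem fun i hi => N.smul_mem _ (hfN i (Finset.mem_insert_of_mem hi))
    have hsumU : ∀ r : ι → ℤ, ∑ i ∈ s, r i • U i ∈ N := fun r =>
      N.sum_mem fun i hi => N.smul_mem _ (hUN i hi)
    have hUsum : ∀ r : ι → ℤ, ∑ i ∈ s, r i • U i =
        ∑ i ∈ s, r i • u i + (∑ i ∈ s, r i * φ (u i)) • y := by
      intro r
      simp only [hU, smul_add, Finset.sum_add_distrib, Finset.sum_smul, mul_smul]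
    have hYN : Y ∈ N := by
      have h := hsumU fun i => B X (f i)
      have h0 : ∑ i ∈ s, B X (f i) * φ (u i) = 0 := by
        have hψ : ∀ ψ : M →ₗ[ℤ] ℤ, ψ X = ∑ i ∈ s, ψ (f i) * φ (u i) := by
          intro ψ
          rw [hX, map_sum]
          exact Finset.sum_congr rfl fun i _ => by rw [map_smul, smul_eq_mul, mul_comm]
        rw [← hψ, hB.self_eq_zero]
      rwa [hUsum, h0, zero_smul, add_zero] at h
    have hs : x + φ x • y ∈ N := by
      have h := N.add_mem (N.add_mem heN (hsumf fun i => φ (u i))) hYN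
      have h1 : x + φ x • y = e + ∑ i ∈ s, φ (u i) • f i + Y := by rw [← hX, he]; abel
      rwa [← h1] at h
    have hyN : y ∈ N := by
      have h := N.sub_mem (N.smul_mem b hs) (N.sub_mem (N.sub_mem
        (hfN a (Finset.mem_insert_self _ _)) (hsumf A)) (hsumU c))
      have h1 : y = b • (x + φ x • y) -
          (f a - ∑ i ∈ s, A i • f i - ∑ i ∈ s, c i • U i) := by
        have h2 : y = (∑ i ∈ s, c i * φ (u i) + b * φ x) • y := by rw [hbez, one_smul]
        rw [hUsum, hfa]
        conv_lhs => rw [h2]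
        module
      rwa [← h1] at h
    intro i hi
    have h := N.sub_mem (hUN i hi) (N.smul_mem (φ (u i)) hyN)
    rwa [hU, add_sub_cancel_right] at h

/-- An isotropic dual family on a subset of the indices gives rise to one on all indices whose
span, together with that of `f`, contains the original one. -/
theorem IsDualOn.exists_univ [Fintype ι] (hB : B.IsAlt) {f : ι → M}
    (hφ : ∀ a, ∃ φ : M →ₗ[ℤ] ℤ, ∀ b, φ (f b) = if b = a then 1 else 0)
    (hpair : ∀ (s : Finset ι) (u : ι → M), s ≠ Finset.univ → IsDualOn B s f u →
      HasHyperbolicPairs B s f u)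
    {s : Finset ι} {u : ι → M} (hd : IsDualOn B s f u) :
    ∃ u' : ι → M, IsDualOn B Finset.univ f u' ∧
      ∀ i ∈ s, u i ∈ Submodule.span ℤ (Set.range f) ⊔ Submodule.span ℤ (Set.range u') := by
  induction hr : sᶜ.card generalizing s u with
  | zero =>
    obtain rfl : s = Finset.univ := by simpa using hr
    exact ⟨u, hd, fun i _ => Submodule.mem_sup_right (Submodule.subset_span ⟨i, rfl⟩)⟩
  | succ r ih =>
    have hs : s ≠ Finset.univ := by rintro rfl; simp at hr
    obtain ⟨a, ha⟩ : ∃ a, a ∉ s := by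
      by_contra! h
      exact hs (Finset.eq_univ_of_forall h)
    obtain ⟨φ, hφa⟩ := hφ a
    obtain ⟨u₁, hd₁, hu₁⟩ := hd.exists_insert hB (hpair s u hs hd) ha φ (by simp [hφa])
      fun i hi => by rw [hφa, if_neg (ne_of_mem_of_not_mem hi ha)]
    obtain ⟨u', hd', hu'⟩ := ih hd₁ (by
      rw [Finset.card_compl, Finset.card_insert_of_notMem ha]
      rw [Finset.card_compl] at hr
      omega)
    refine ⟨u', hd', fun i hi => ?_⟩
    refine (sup_le ?_ ?_ : _ ≤ Submodule.span ℤ (Set.range f) ⊔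
      Submodule.span ℤ (Set.range u')) (hu₁ i hi)
    · exact (Submodule.span_mono (Set.image_subset_range _ _)).trans le_sup_left
    · rw [Submodule.span_le]
      rintro _ ⟨j, hj, rfl⟩
      exact hu' j hj

end Alternating

theorem symp_swap {R : Type*} [CommRing R] {g : ℕ} (x y : Fin (2 * g) → R) :
    symp x y = -symp y x := by
  unfold symp
  rw [← Finset.sum_neg_distrib]
  exact Finset.sum_congr rfl fun i _ => by ring

/-- `symp` as a bilinear form. -/
def sympForm (g : ℕ) : (Fin (2 * g) → ℤ) →ₗ[ℤ] (Fin (2 * g) → ℤ) →ₗ[ℤ] ℤ :=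
  LinearMap.mk₂ ℤ symp symp_add_left symp_smul_left
    (fun x y z => by
      rw [symp_swap, symp_add_left, symp_swap y, symp_swap z, neg_add, neg_neg, neg_neg,
        symp_swap x y, symp_swap x z])
    (fun c x y => by rw [symp_swap, symp_smul_left, symp_swap x y, smul_eq_mul, mul_neg])

theorem sympForm_apply {g : ℕ} (x y : Fin (2 * g) → ℤ) : sympForm g x y = symp x y := rfl

theorem isAlt_sympForm (g : ℕ) : (sympForm g).IsAlt := fun x => by
  rw [sympForm_apply]
  unfold symp
  exact Finset.sum_eq_zero fun i _ => by ring

theorem symp_single_odd {g : ℕ} (x : Fin (2 * g) → ℤ) (i : Fin g) :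
    symp x (Pi.single ⟨2 * i.1 + 1, by omega⟩ 1) = x ⟨2 * i.1, by omega⟩ := by
  unfold symp
  rw [Finset.sum_eq_single i]
  · simp
  · intro j _ hj
    have : (j : ℕ) ≠ i := fun h => hj (Fin.ext h)
    simp [Pi.single_apply, this]
    omega
  · simp

theorem symp_single_even {g : ℕ} (x : Fin (2 * g) → ℤ) (i : Fin g) :
    symp x (Pi.single ⟨2 * i.1, by omega⟩ 1) = -x ⟨2 * i.1 + 1, by omega⟩ := by
  unfold symp
  rw [Finset.sum_eq_single i]
  · simp
  · intro j _ hj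
    have : (j : ℕ) ≠ i := fun h => hj (Fin.ext h)
    simp [Pi.single_apply, this]
    omega
  · simp

theorem exists_smul_symp_eq_one {g : ℕ} {t : Fin (2 * g) → ℤ} (ht : t ≠ 0) :
    ∃ (b : ℤ) (x y : Fin (2 * g) → ℤ), b ≠ 0 ∧ t = b • x ∧ symp x y = 1 := by
  obtain ⟨b, hb⟩ := (IsPrincipalIdealRing.principal (LinearMap.range (sympForm g t))).principal
  have hdvd : ∀ z, b ∣ symp t z := fun z => by
    have h : sympForm g t z ∈ LinearMap.range (sympForm g t) := ⟨z, rfl⟩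
    rw [hb] at h
    exact Ideal.mem_span_singleton.1 h
  obtain ⟨y, hy⟩ : b ∈ LinearMap.range (sympForm g t) := by
    rw [hb]
    exact Submodule.mem_span_singleton_self b
  have hcoord : ∀ j, b ∣ t j := by
    intro j
    rcases Nat.even_or_odd' j.1 with ⟨c, hc | hc⟩
    · have h := hdvd (Pi.single ⟨2 * c + 1, by omega⟩ 1)
      rw [symp_single_odd t ⟨c, by omega⟩] at h
      rwa [show j = ⟨2 * c, by omega⟩ from Fin.ext hc]
    · have h := hdvd (Pi.single ⟨2 * c, by omega⟩ 1)
      rw [symp_single_even t ⟨c, by omega⟩, dvd_neg] at h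
      rwa [show j = ⟨2 * c + 1, by omega⟩ from Fin.ext hc]
  choose x hx using hcoord
  have htx : t = b • x := funext hx
  have hb0 : b ≠ 0 := by
    rintro rfl
    exact ht (by rw [htx, zero_smul])
  refine ⟨b, x, y, hb0, htx, mul_left_cancel₀ hb0 ?_⟩
  rw [← symp_smul_left, ← htx, mul_one]
  exact hy

theorem exists_ne_zero_symp_eq_zero {g : ℕ} {κ : Type*} [Fintype κ]
    (hκ : Fintype.card κ < 2 * g) (z : κ → Fin (2 * g) → ℤ) :
    ∃ t ≠ 0, ∀ i, symp t (z i) = 0 := by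
  have hker : LinearMap.ker (LinearMap.pi fun i => (sympForm g).flip (z i)) ≠ ⊥ := fun h => by
    have hle := LinearMap.finrank_le_finrank_of_injective (LinearMap.ker_eq_bot.1 h)
    rw [Module.finrank_fin_fun, Module.finrank_fintype_fun_eq_card] at hle
    omega
  obtain ⟨t, ht, ht0⟩ := Submodule.exists_mem_ne_zero_of_ne_bot hker
  exact ⟨t, ht0, fun i => congrFun (LinearMap.mem_ker.1 ht) i⟩

theorem mem_perp_sup_span_iff {g : ℕ} {κ : Type*} {p q : κ → Fin (2 * g) → ℤ}
    {x : Fin (2 * g) → ℤ} :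
    x ∈ perp ((Submodule.span ℤ (Set.range p) ⊔ Submodule.span ℤ (Set.range q) :
      Submodule ℤ (Fin (2 * g) → ℤ)) : Set (Fin (2 * g) → ℤ)) ↔
      ∀ i, symp x (p i) = 0 ∧ symp x (q i) = 0 := by
  constructor
  · intro h i
    exact ⟨h _ (Submodule.mem_sup_left (Submodule.subset_span ⟨i, rfl⟩)),
      h _ (Submodule.mem_sup_right (Submodule.subset_span ⟨i, rfl⟩))⟩
  · intro h
    have hle : Submodule.span ℤ (Set.range p) ⊔ Submodule.span ℤ (Set.range q) ≤
        LinearMap.ker (sympForm g x) := by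
      refine sup_le ?_ ?_ <;> rw [Submodule.span_le] <;> rintro _ ⟨i, rfl⟩
      · exact (h i).1
      · exact (h i).2
    exact fun a ha => hle ha

theorem IsUnimodular.exists_dual {n m : ℕ} {v : Fin m → Fin n → ℤ} (hv : IsUnimodular v)
    (a : Fin m) : ∃ φ : (Fin n → ℤ) →ₗ[ℤ] ℤ, ∀ b, φ (v b) = if b = a then 1 else 0 := by
  obtain ⟨hli, C, hC⟩ := hv
  refine ⟨(Module.Basis.span hli).coord a ∘ₗ Submodule.projectionOnto _ C hC, fun b => ?_⟩
  have h : v b = ((Module.Basis.span hli b : Submodule.span ℤ (Set.range v)) : Fin n → ℤ) := by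
    rw [Module.Basis.span_apply]
  rw [LinearMap.comp_apply]
  conv_lhs => rw [h]
  rw [Submodule.projectionOnto_apply_left, Module.Basis.coord_apply,
    Module.Basis.repr_self, Finsupp.single_apply]

theorem isUnimodular_of_dual {n m : ℕ} {v : Fin m → Fin n → ℤ}
    (φ : Fin m → (Fin n → ℤ) →ₗ[ℤ] ℤ) (h : ∀ i j, φ i (v j) = if i = j then 1 else 0) :
    IsUnimodular v := by
  have hsum : ∀ (c : Fin m → ℤ) i, φ i (∑ j, c j • v j) = c i := by
    intro c i
    rw [map_sum]
    simp only [map_smul, h, smul_eq_mul, mul_ite, mul_one, mul_zero, Finset.sum_ite_eq,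
      Finset.mem_univ, if_true]
  refine ⟨?_, LinearMap.ker (LinearMap.pi φ), ?_, ?_⟩
  · rw [Fintype.linearIndependent_iff]
    intro c hc i
    rw [← hsum c i, hc, map_zero]
  · rw [Submodule.disjoint_def]
    intro x hx hx0
    obtain ⟨c, rfl⟩ := (Submodule.mem_span_range_iff_exists_fun ℤ).1 hx
    refine Finset.sum_eq_zero fun i _ => ?_
    rw [← hsum c i, show φ i (∑ j, c j • v j) = 0 from congrFun (LinearMap.mem_ker.1 hx0) i,
      zero_smul]
  · rw [codisjoint_iff, eq_top_iff]
    intro x _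
    rw [← add_sub_cancel (∑ j, φ j x • v j) x]
    refine Submodule.add_mem_sup ?_ ?_
    · exact Submodule.sum_mem _ fun j _ => Submodule.smul_mem _ _ (Submodule.subset_span ⟨j, rfl⟩)
    · rw [LinearMap.mem_ker]
      funext i
      rw [map_sub, Pi.sub_apply, LinearMap.pi_apply, LinearMap.pi_apply, hsum, sub_self,
        Pi.zero_apply]

/-- relative dual summands, Prop. 2.11 (iv). -/
theorem stmt7 (g m n k : ℕ) (hm : 1 ≤ m) (hn : 1 ≤ n) (hk : 1 ≤ k)
    (hg : m + n + k ≤ g)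
    (p : Fin m → Fin (2 * g) → ℤ) (hp : IsUnimodular p)
    (q : Fin m → Fin (2 * g) → ℤ) (hq : IsUnimodular q)
    (hqiso : ∀ i j, symp (q i) (q j) = 0)
    (hpq : ∀ i j, symp (p i) (q j) = if i = j then 1 else 0)
    (v : Fin n → Fin (2 * g) → ℤ) (hv : IsUnimodular v)
    (d : Fin n → Fin (2 * g) → ℤ) (hd : IsUnimodular d)
    (hdT : ∀ j, d j ∈ perp ((Submodule.span ℤ (Set.range p) ⊔ Submodule.span ℤ (Set.range q) :
      Submodule ℤ (Fin (2 * g) → ℤ)) : Set (Fin (2 * g) → ℤ)))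
    (hdiso : ∀ i j, symp (d i) (d j) = 0)
    (hvd : ∀ i j, symp (v i) (d j) = if i = j then 1 else 0)
    (w : Fin k → Fin (2 * g) → ℤ)
    (hall : IsUnimodular (Fin.append w (Fin.append p (Fin.append q v)))) :
    ∃ u₃ : Fin (n + k) → Fin (2 * g) → ℤ,
      (∀ j, u₃ j ∈ perp ((Submodule.span ℤ (Set.range p) ⊔ Submodule.span ℤ (Set.range q) :
        Submodule ℤ (Fin (2 * g) → ℤ)) : Set (Fin (2 * g) → ℤ))) ∧
      IsUnimodular u₃ ∧
      (∀ i j, symp (u₃ i) (u₃ j) = 0) ∧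
      (∀ i j, symp (Fin.append v w i) (u₃ j) = if i = j then 1 else 0) ∧
      Submodule.span ℤ (Set.range v) ⊔ Submodule.span ℤ (Set.range d) ≤
        Submodule.span ℤ (Set.range p) ⊔ Submodule.span ℤ (Set.range q) ⊔
          Submodule.span ℤ (Set.range (Fin.append v w)) ⊔ Submodule.span ℤ (Set.range u₃) := by
  classical
  set T := perp ((Submodule.span ℤ (Set.range p) ⊔ Submodule.span ℤ (Set.range q) :
    Submodule ℤ (Fin (2 * g) → ℤ)) : Set (Fin (2 * g) → ℤ)) with hT
  set N₀ := Submodule.span ℤ (Set.range p) ⊔ Submodule.span ℤ (Set.range q) with hN₀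
  have hN₀T : ∀ z ∈ N₀, ∀ x ∈ T, symp z x = 0 := fun z hz x hx => by
    rw [symp_swap, hx z hz, neg_zero]
  have hproj : ∀ x, ∃ x' ∈ T, x - x' ∈ N₀ := by
    intro x
    obtain ⟨a, c, h⟩ := exists_sub_orthogonal (isAlt_sympForm g) Finset.univ p q
      (fun i _ j _ => hqiso i j) (fun i _ j _ => hpq i j) x
    refine ⟨_, mem_perp_sup_span_iff.2 fun i => h i (Finset.mem_univ i), ?_⟩
    rw [sub_sub, sub_sub_cancel]
    refine Submodule.add_mem_sup ?_ ?_ <;>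
      exact Submodule.sum_mem _ fun j _ => Submodule.smul_mem _ _ (Submodule.subset_span ⟨j, rfl⟩)
  have hsymp_congr : ∀ {x x' y}, x - x' ∈ N₀ → y ∈ T → symp x' y = symp x y := by
    intro x x' y hx hy
    rw [← sub_add_cancel x x', symp_add_left, hN₀T _ hx _ hy, zero_add]
  set F := Fin.append v w with hF
  choose f₀ hf₀T hf₀ using fun i => hproj (F i)
  set f : Fin (n + k) → T := fun i => ⟨f₀ i, hf₀T i⟩ with hf
  set B : T →ₗ[ℤ] T →ₗ[ℤ] ℤ := (sympForm g).domRestrict₁₂ T T with hBdef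
  have hBs : ∀ x y : T, B x y = symp (x : Fin (2 * g) → ℤ) y := fun _ _ => rfl
  have hB : B.IsAlt := fun x => isAlt_sympForm g x
  have hfF : ∀ i (y : T), B (f i) y = symp (F i) y := fun i y => hsymp_congr (hf₀ i) y.2
  have hφ : ∀ a, ∃ φ : T →ₗ[ℤ] ℤ, ∀ b, φ (f b) = if b = a then 1 else 0 := by
    intro a
    set σ : Fin (n + k) → Fin (k + (m + (m + n))) :=
      Fin.append (fun j => Fin.natAdd k (Fin.natAdd m (Fin.natAdd m j))) (Fin.castAdd _) with hσ
    have hσF : ∀ i, Fin.append w (Fin.append p (Fin.append q v)) (σ i) = F i := by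
      intro i
      refine Fin.addCases (fun j => ?_) (fun j => ?_) i <;> simp [hσ, hF]
    have hσinj : Function.Injective σ := by
      intro i j
      refine Fin.addCases (fun i => ?_) (fun i => ?_) i <;>
        refine Fin.addCases (fun j => ?_) (fun j => ?_) j <;>
        simp [hσ, Fin.ext_iff] <;> omega
    have hσp : ∀ i j, Fin.natAdd k (Fin.castAdd (m + n) j) ≠ σ i := by
      intro i j
      refine Fin.addCases (fun i => ?_) (fun i => ?_) i <;> simp [hσ, Fin.ext_iff] <;> omega
    have hσq : ∀ i j, Fin.natAdd k (Fin.natAdd m (Fin.castAdd n j)) ≠ σ i := by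
      intro i j
      refine Fin.addCases (fun i => ?_) (fun i => ?_) i <;> simp [hσ, Fin.ext_iff] <;> omega
    obtain ⟨φ, hφ⟩ := hall.exists_dual (σ a)
    have hφN₀ : N₀ ≤ LinearMap.ker φ := by
      refine sup_le ?_ ?_ <;> rw [Submodule.span_le] <;> rintro _ ⟨i, rfl⟩
      · have h := hφ (Fin.natAdd k (Fin.castAdd (m + n) i))
        rwa [if_neg (hσp a i), Fin.append_right, Fin.append_left] at h
      · have h := hφ (Fin.natAdd k (Fin.natAdd m (Fin.castAdd n i)))
        rwa [if_neg (hσq a i), Fin.append_right, Fin.append_right, Fin.append_left] at h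
    refine ⟨φ ∘ₗ T.subtype, fun b => ?_⟩
    have h1 : φ (F b - f₀ b) = 0 := hφN₀ (hf₀ b)
    have h2 := hφ (σ b)
    simp only [hσF, hσinj.eq_iff] at h2
    rw [map_sub, h2, sub_eq_zero] at h1
    exact h1.symm
  have hpair : ∀ (s : Finset (Fin (n + k))) (u : Fin (n + k) → T), s ≠ Finset.univ →
      IsDualOn B s f u → HasHyperbolicPairs B s f u := by
    intro s u hs hu
    have main : ∀ t : T, t ≠ 0 → (∀ i ∈ s, B t (f i) = 0 ∧ B t (u i) = 0) →
        ∃ (b : ℤ) (x y : T), t = b • x ∧ B x y = 1 ∧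
          (∀ i ∈ s, B x (f i) = 0 ∧ B x (u i) = 0) ∧
          ∀ i ∈ s, B y (f i) = 0 ∧ B y (u i) = 0 := by
      intro t ht0 ht
      obtain ⟨b, x, y, hb, htx, hxy⟩ :=
        exists_smul_symp_eq_one (t := (t : Fin (2 * g) → ℤ)) (by simpa using ht0)
      have hdiv : ∀ z, symp (t : Fin (2 * g) → ℤ) z = 0 → symp x z = 0 := by
        intro z hz
        rw [htx, symp_smul_left] at hz
        exact (mul_eq_zero.1 hz).resolve_left hb
      have hxT : x ∈ T := fun z hz => hdiv z (t.2 z hz)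
      have hxs : ∀ i ∈ s, B ⟨x, hxT⟩ (f i) = 0 ∧ B ⟨x, hxT⟩ (u i) = 0 := fun i hi =>
        ⟨hdiv _ (ht i hi).1, hdiv _ (ht i hi).2⟩
      obtain ⟨y', hy'T, hy'⟩ := hproj y
      obtain ⟨a, c, hac⟩ := exists_sub_orthogonal hB s f u hu.1 hu.2 ⟨y', hy'T⟩
      refine ⟨b, ⟨x, hxT⟩, _, Subtype.ext htx, ?_, hxs, hac⟩
      have h1 : B ⟨x, hxT⟩ ⟨y', hy'T⟩ = 1 := by
        rw [hBs, symp_swap, hsymp_congr hy' hxT, ← symp_swap, hxy]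
      rw [map_sub, map_sub, map_sum, map_sum, h1, Finset.sum_eq_zero, Finset.sum_eq_zero]
      · simp
      · intro i hi
        rw [map_smul, (hxs i hi).2, smul_zero]
      · intro i hi
        rw [map_smul, (hxs i hi).1, smul_zero]
    intro t ht
    by_cases ht0 : t = 0
    · have hcard : s.card < n + k := by
        simpa using Finset.card_lt_univ_of_notMem
          (not_forall.1 fun h => hs (Finset.eq_univ_of_forall h)).choose_spec
      obtain ⟨t₁, ht₁, h₁⟩ := exists_ne_zero_symp_eq_zero (g := g)
        (κ := (Fin m ⊕ Fin m) ⊕ (s ⊕ s)) (by simp; omega)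
        (Sum.elim (Sum.elim p q) (Sum.elim (fun i => (f i : Fin (2 * g) → ℤ)) fun i => u i))
      have ht₁T : t₁ ∈ T := mem_perp_sup_span_iff.2 fun i =>
        ⟨h₁ (Sum.inl (Sum.inl i)), h₁ (Sum.inl (Sum.inr i))⟩
      obtain ⟨b, x, y, -, hxy, hx, hy⟩ := main ⟨t₁, ht₁T⟩ (by simpa using ht₁) fun i hi =>
        ⟨h₁ (Sum.inr (Sum.inl ⟨i, hi⟩)), h₁ (Sum.inr (Sum.inr ⟨i, hi⟩))⟩
      exact ⟨0, x, y, by rw [ht0, zero_smul], hxy, hx, hy⟩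
    · exact main t ht0 ht
  set u₀ : Fin (n + k) → T := Fin.append (fun j => ⟨d j, hdT j⟩) 0 with hu₀
  have hd₀ : IsDualOn B (Finset.univ.image (Fin.castAdd k)) f u₀ := by
    constructor
    · intro i hi j hj
      obtain ⟨i, -, rfl⟩ := Finset.mem_image.1 hi
      obtain ⟨j, -, rfl⟩ := Finset.mem_image.1 hj
      simpa [hu₀, hBs] using hdiso i j
    · intro i hi j hj
      obtain ⟨i, -, rfl⟩ := Finset.mem_image.1 hi
      obtain ⟨j, -, rfl⟩ := Finset.mem_image.1 hj
      rw [hfF]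
      simpa [hu₀, hF] using hvd i j
  obtain ⟨u, hu, hspan⟩ := hd₀.exists_univ hB hφ hpair
  have hFu : ∀ i j, symp (F i) (u j) = if i = j then 1 else 0 := fun i j => by
    rw [← hfF]
    exact hu.2 i (Finset.mem_univ i) j (Finset.mem_univ j)
  refine ⟨fun j => u j, fun j => (u j).2, isUnimodular_of_dual (fun i => sympForm g (F i)) hFu,
    fun i j => hu.1 i (Finset.mem_univ i) j (Finset.mem_univ j), hFu, sup_le ?_ ?_⟩
  · rw [Submodule.span_le]
    rintro _ ⟨j, rfl⟩
    refine Submodule.mem_sup_left (Submodule.mem_sup_right (Submodule.subset_span ?_))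
    exact ⟨Fin.castAdd k j, by simp [hF]⟩
  · rw [Submodule.span_le]
    rintro _ ⟨j, rfl⟩
    have hle : Submodule.span ℤ (Set.range f) ⊔ Submodule.span ℤ (Set.range u) ≤
        (N₀ ⊔ Submodule.span ℤ (Set.range F) ⊔
          Submodule.span ℤ (Set.range fun j => (u j : Fin (2 * g) → ℤ))).comap T.subtype := by
      refine sup_le ?_ ?_ <;> rw [Submodule.span_le] <;> rintro _ ⟨i, rfl⟩
      · refine Submodule.mem_sup_left ?_
        have h := Submodule.sub_mem (N₀ ⊔ Submodule.span ℤ (Set.range F))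
          (Submodule.mem_sup_right (Submodule.subset_span ⟨i, rfl⟩))
          (Submodule.mem_sup_left (hf₀ i))
        rwa [sub_sub_cancel] at h
      · exact Submodule.mem_sup_right (Submodule.subset_span ⟨i, rfl⟩)
    have h := hle (hspan (Fin.castAdd k j) (Finset.mem_image_of_mem _ (Finset.mem_univ j)))
    simpa [hu₀] using h


end Paper
end

section
/- Let v_0, v_1, …, v_k ∈ H be linearly independent, pairwise ω-orthogonal vectors, each with a_1-coordinate equal to 1, and suppose that the projections pr₂(v_0), …, pr₂(v_k) ∈ H₂ are ℚ-linearly dependent. Then all the b_1-coordinates of v_0, …, v_k are equal; call this common value t. Moreover, if w ∈ H has a_1-coordinate 1, is ω-orthogonal to each v_i, and v_0, …, v_k, w are linearly independent, then the b_1-coordinate of w also equals t. -/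
namespace Paper

theorem symp_self {R : Type*} [CommRing R] {g : ℕ} (x : Fin (2 * g) → R) :
    symp x x = 0 := by
  unfold symp
  exact Finset.sum_eq_zero fun i _ => by ring

theorem symp_sum_smul_left {R ι : Type*} [CommRing R] {g : ℕ} (s : Finset ι) (c : ι → R)
    (v : ι → Fin (2 * g) → R) (a : Fin (2 * g) → R) :
    symp (∑ i ∈ s, c i • v i) a = ∑ i ∈ s, c i * symp (v i) a := by
  classical
  induction s using Finset.induction_on with
  | empty => simp [symp_zero_left]
  | insert i s hi ih =>
    rw [Finset.sum_insert hi, Finset.sum_insert hi, symp_add_left, symp_smul_left, ih]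

/-- Pairing with a vector in the span of `a_1, b_1` only sees the first two coordinates. -/
theorem symp_of_vanish {R : Type*} [CommRing R] {g : ℕ} (u x : Fin (2 * (g + 1)) → R)
    (hu : ∀ j : Fin (2 * (g + 1)), 2 ≤ (j : ℕ) → u j = 0)
    (h0 : 0 < 2 * (g + 1)) (h1 : 1 < 2 * (g + 1)) :
    symp u x = u ⟨0, h0⟩ * x ⟨1, h1⟩ - u ⟨1, h1⟩ * x ⟨0, h0⟩ := by
  unfold symp
  rw [Finset.sum_eq_single_of_mem (0 : Fin (g + 1)) (Finset.mem_univ _)]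
  · rfl
  · intro i _ hi
    have hpos : 1 ≤ (i : ℕ) := Nat.one_le_iff_ne_zero.mpr (Fin.val_ne_zero_iff.mpr hi)
    rw [hu _ (show 2 ≤ 2 * (i : ℕ) by omega), hu _ (show 2 ≤ 2 * (i : ℕ) + 1 by omega)]
    ring

/-- A rational dependence between the projections clears denominators to an integral one. -/
theorem exists_int_relation {n k : ℕ} (v : Fin k → Fin n → ℤ)
    (hdep : ¬ LinearIndependent ℚ fun i => qcast (pr2 (v i))) :
    ∃ c : Fin k → ℤ, (∃ i, c i ≠ 0) ∧
      ∀ j : Fin n, 2 ≤ (j : ℕ) → (∑ i, c i • v i) j = 0 := by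
  rw [← LinearIndependent.iff_fractionRing ℤ ℚ, Fintype.not_linearIndependent_iff] at hdep
  obtain ⟨c, hc, hne⟩ := hdep
  refine ⟨c, hne, fun j hj => ?_⟩
  have h := congrFun hc j
  simp only [Finset.sum_apply, Pi.smul_apply, qcast, pr2, if_neg (not_lt.mpr hj), Pi.zero_apply,
    ← Int.cast_smul_eq_zsmul ℚ, smul_eq_mul] at h
  simp only [Finset.sum_apply, Pi.smul_apply, smul_eq_mul]
  exact_mod_cast h

/-- Lemma 2.19 — if the projections `pr₂(v_i)` are ℚ-linearly
dependent, then all `b_1`-coordinates agree, also for any further vector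
orthogonal to the family. -/
theorem stmt8 (g k : ℕ) (v : Fin (k + 1) → Fin (2 * (g + 1)) → ℤ)
    (hli : LinearIndependent ℤ v)
    (horth : ∀ i j, i ≠ j → symp (v i) (v j) = 0)
    (ha1 : ∀ i, v i ⟨0, by omega⟩ = 1)
    (hdep : ¬ LinearIndependent ℚ fun i => qcast (pr2 (v i))) :
    (∀ i j, v i ⟨1, by omega⟩ = v j ⟨1, by omega⟩) ∧
    ∀ w : Fin (2 * (g + 1)) → ℤ, w ⟨0, by omega⟩ = 1 →
      (∀ i, symp w (v i) = 0) →
      LinearIndependent ℤ (Fin.snoc v w) →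
      w ⟨1, by omega⟩ = v 0 ⟨1, by omega⟩ := by
  obtain ⟨c, ⟨i₀, hi₀⟩, hvan⟩ := exists_int_relation v hdep
  set u := ∑ i, c i • v i with hu
  have hu0 : u ≠ 0 := fun h => hi₀ (Fintype.linearIndependent_iff.mp hli c h i₀)
  have key : ∀ x : Fin (2 * (g + 1)) → ℤ, x ⟨0, by omega⟩ = 1 → (∀ i, symp (v i) x = 0) →
      u ⟨0, by omega⟩ * x ⟨1, by omega⟩ = u ⟨1, by omega⟩ := by
    intro x hx hxv
    have h : symp u x = 0 := by
      rw [hu, symp_sum_smul_left]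
      exact Finset.sum_eq_zero fun i _ => by rw [hxv i, mul_zero]
    rw [symp_of_vanish u x hvan (by omega) (by omega), hx] at h
    linarith
  have hv : ∀ j i, symp (v i) (v j) = 0 := by
    intro j i
    by_cases hij : i = j
    · rw [hij, symp_self]
    · exact horth i j hij
  have hA : u ⟨0, by omega⟩ ≠ 0 := by
    intro hA
    have hB := key (v 0) (ha1 0) (hv 0)
    rw [hA, zero_mul] at hB
    refine hu0 (funext fun j => ?_)
    obtain ⟨_ | _ | j, hj⟩ := j
    · exact hA
    · exact hB.symm
    · exact hvan _ (Nat.le_add_left 2 j)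
  refine ⟨fun i j => mul_left_cancel₀ hA ?_, fun w hw hwv _ => mul_left_cancel₀ hA ?_⟩
  · rw [key _ (ha1 i) (hv i), key _ (ha1 j) (hv j)]
  · rw [key w hw fun i => by rw [symp_swap, hwv i, neg_zero], key _ (ha1 0) (hv 0)]
end Paper
end

section
/- Let U ⊆ V be a ℚ-subspace, let w_1, w_2, w_3, w_4 ∈ U^⊥ be pairwise ω-orthogonal vectors, and let u_1, u_2, u_3 ∈ U^⊥ be pairwise ω-orthogonal vectors with ω(w_i, u_j) = δ_{ij} for all i ∈ {1,2,3,4} and j ∈ {1,2,3}. Then, inside Λ³V, the following three internal direct sum decompositions hold: (1) Λ³(U^⊥ ∩ w_2^⊥) = u_1∧Λ²(U^⊥ ∩ w_2^⊥) ⊕ Λ³(U^⊥ ∩ w_1^⊥ ∩ w_2^⊥); (2) Λ³(U^⊥ ∩ w_3^⊥) = u_1∧u_2∧(U^⊥ ∩ w_3^⊥) ⊕ Λ³(U^⊥ ∩ w_1^⊥ ∩ w_3^⊥) ⊕ u_1∧Λ²(U^⊥ ∩ w_2^⊥ ∩ w_3^⊥); (3) Λ³(U^⊥ ∩ w_4^⊥)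 = ℚ·(u_1∧u_2∧u_3) ⊕ Λ³(U^⊥ ∩ w_1^⊥ ∩ w_4^⊥) ⊕ u_1∧Λ²(U^⊥ ∩ w_2^⊥ ∩ w_4^⊥) ⊕ u_1∧u_2∧(U^⊥ ∩ w_3^⊥ ∩ w_4^⊥). -/
namespace Paper

theorem ι_mul_ι_comm {R M : Type*} [CommRing R] [AddCommGroup M] [Module R M] (x y : M) :
    ExteriorAlgebra.ι R x * ExteriorAlgebra.ι R y =
      -(ExteriorAlgebra.ι R y * ExteriorAlgebra.ι R x) :=
  eq_neg_of_add_eq_zero_left (ExteriorAlgebra.ι_add_mul_swap x y)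

theorem mem_perp_singleton {R : Type*} [CommRing R] {g : ℕ} {x v : Fin (2 * g) → R} :
    x ∈ perp {v} ↔ symp x v = 0 := by
  simp [perp]

/-- The linear functional `ω(·, v)`. -/
def sympRight {R : Type*} [CommRing R] {g : ℕ} (v : Fin (2 * g) → R) :
    Module.Dual R (Fin (2 * g) → R) where
  toFun x := symp x v
  map_add' x y := symp_add_left x y v
  map_smul' c x := symp_smul_left c x v

theorem add_smul_mem_perp_singleton {R : Type*} [CommRing R] {g : ℕ} {u v : Fin (2 * g) → R}
    (huv : symp u v = -1) (z : Fin (2 * g) → R) : z + symp z v • u ∈ perp {v} := by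
  rw [mem_perp_singleton, symp_add_left, symp_smul_left, huv]
  ring

section Wedges

open CliffordAlgebra (contractLeft contractLeft_ι_mul contractLeft_one)

variable {g : ℕ} {u u' v : Fin (2 * g) → ℚ} {W W' : Submodule ℚ (Fin (2 * g) → ℚ)}

theorem wedge_mem_wedge3 {x y z : Fin (2 * g) → ℚ} (hx : x ∈ W) (hy : y ∈ W) (hz : z ∈ W) :
    ExteriorAlgebra.ι ℚ x * ExteriorAlgebra.ι ℚ y * ExteriorAlgebra.ι ℚ z ∈ wedge3 W :=
  Submodule.subset_span ⟨x, hx, y, hy, z, hz, rfl⟩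

theorem wedge_mem_uWedge2 {y z : Fin (2 * g) → ℚ} (hy : y ∈ W) (hz : z ∈ W) :
    ExteriorAlgebra.ι ℚ u * ExteriorAlgebra.ι ℚ y * ExteriorAlgebra.ι ℚ z ∈ uWedge2 u W :=
  Submodule.subset_span ⟨y, hy, z, hz, rfl⟩

theorem wedge_mem_uuWedge1 {z : Fin (2 * g) → ℚ} (hz : z ∈ W) :
    ExteriorAlgebra.ι ℚ u * ExteriorAlgebra.ι ℚ u' * ExteriorAlgebra.ι ℚ z ∈ uuWedge1 u u' W :=
  Submodule.subset_span ⟨z, hz, rfl⟩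

theorem wedge3_mono (h : W ≤ W') : wedge3 W ≤ wedge3 W' := by
  refine Submodule.span_le.2 ?_
  rintro _ ⟨x, hx, y, hy, z, hz, rfl⟩
  exact wedge_mem_wedge3 (h hx) (h hy) (h hz)

theorem uWedge2_mono (h : W ≤ W') : uWedge2 u W ≤ uWedge2 u W' := by
  refine Submodule.span_le.2 ?_
  rintro _ ⟨y, hy, z, hz, rfl⟩
  exact wedge_mem_uWedge2 (h hy) (h hz)

theorem uuWedge1_mono (h : W ≤ W') : uuWedge1 u u' W ≤ uuWedge1 u u' W' := by
  refine Submodule.span_le.2 ?_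
  rintro _ ⟨z, hz, rfl⟩
  exact wedge_mem_uuWedge1 (h hz)

theorem uWedge2_le_wedge3 (hu : u ∈ W) : uWedge2 u W ≤ wedge3 W := by
  refine Submodule.span_le.2 ?_
  rintro _ ⟨y, hy, z, hz, rfl⟩
  exact wedge_mem_wedge3 hu hy hz

theorem uuWedge1_le_uWedge2 (hu' : u' ∈ W) : uuWedge1 u u' W ≤ uWedge2 u W := by
  refine Submodule.span_le.2 ?_
  rintro _ ⟨z, hz, rfl⟩
  exact wedge_mem_uWedge2 hu' hz

theorem uuWedge1_le_uWedge2_right (hu : u ∈ W) : uuWedge1 u u' W ≤ uWedge2 u' W := by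
  refine Submodule.span_le.2 ?_
  rintro _ ⟨z, hz, rfl⟩
  rw [ι_mul_ι_comm u, neg_mul]
  exact neg_mem (wedge_mem_uWedge2 hu hz)

theorem ι_mul_contractLeft_of_mem_uWedge2 (huv : symp u v = -1)
    {a : ExteriorAlgebra ℚ (Fin (2 * g) → ℚ)} (ha : a ∈ uWedge2 u W) :
    ExteriorAlgebra.ι ℚ u * contractLeft (Q := 0) (sympRight v) a = -a := by
  induction ha using Submodule.span_induction with
  | mem x hx =>
    obtain ⟨y, -, z, -, rfl⟩ := hx
    have key (t : ExteriorAlgebra ℚ (Fin (2 * g) → ℚ)) :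
        ExteriorAlgebra.ι ℚ u *
          contractLeft (Q := 0) (sympRight v) (ExteriorAlgebra.ι ℚ u * t) =
        -(ExteriorAlgebra.ι ℚ u * t) := by
      have h := contractLeft_ι_mul (Q := (0 : QuadraticForm ℚ (Fin (2 * g) → ℚ)))
        (sympRight v) u t
      have hu : sympRight v u = -1 := huv
      rw [hu, neg_one_smul] at h
      refine (congrArg (ExteriorAlgebra.ι ℚ u * ·) h).trans ?_
      change ExteriorAlgebra.ι ℚ u * (-t - ExteriorAlgebra.ι ℚ u * _) = _
      rw [mul_sub, ← mul_assoc (ExteriorAlgebra.ι ℚ u), ExteriorAlgebra.ι_sq_zero, zero_mul,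
        sub_zero, mul_neg]
    rw [mul_assoc]
    exact key _
  | zero => simp
  | add x y _ _ hx hy => rw [map_add, mul_add, hx, hy, neg_add]
  | smul c x _ hx => rw [map_smul, mul_smul_comm, hx, smul_neg]

theorem contractLeft_eq_zero_of_mem_wedge3
    {b : ExteriorAlgebra ℚ (Fin (2 * g) → ℚ)} (hb : b ∈ wedge3 (perp {v})) :
    contractLeft (Q := 0) (sympRight v) b = 0 := by
  induction hb using Submodule.span_induction with
  | mem x hx =>
    obtain ⟨x, hx, y, hy, z, hz, rfl⟩ := hx
    have key {s : Fin (2 * g) → ℚ} (hs : s ∈ perp {v})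
        {t : ExteriorAlgebra ℚ (Fin (2 * g) → ℚ)}
        (ht : contractLeft (Q := 0) (sympRight v) t = 0) :
        contractLeft (Q := 0) (sympRight v) (ExteriorAlgebra.ι ℚ s * t) = 0 := by
      refine (contractLeft_ι_mul (sympRight v) s t).trans ?_
      have hs' : sympRight v s = 0 := mem_perp_singleton.1 hs
      rw [hs', ht, zero_smul, mul_zero, sub_zero]
    have hz' : contractLeft (Q := 0) (sympRight v) (ExteriorAlgebra.ι ℚ z) = 0 := by
      simpa using key hz (contractLeft_one 0 (sympRight v))
    rw [mul_assoc]
    exact key hx (key hy hz')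
  | zero => simp
  | add x y _ _ hx hy => rw [map_add, hx, hy, add_zero]
  | smul c x _ hx => rw [map_smul, hx, smul_zero]

theorem eq_zero_of_uWedge2_add_wedge3 (huv : symp u v = -1)
    {a b : ExteriorAlgebra ℚ (Fin (2 * g) → ℚ)} (ha : a ∈ uWedge2 u W)
    (hb : b ∈ wedge3 (perp {v})) (hab : a + b = 0) : a = 0 ∧ b = 0 := by
  have h : contractLeft (Q := 0) (sympRight v) a = 0 := by
    rw [eq_neg_of_add_eq_zero_left hab, map_neg, contractLeft_eq_zero_of_mem_wedge3 hb, neg_zero]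
  have ha0 : a = 0 := by
    rw [← neg_eq_zero, ← ι_mul_contractLeft_of_mem_uWedge2 huv ha, h, mul_zero]
  exact ⟨ha0, by rwa [ha0, zero_add] at hab⟩

theorem exists_smul_add (huv : symp u v = -1) (hu : u ∈ W) {z : Fin (2 * g) → ℚ} (hz : z ∈ W) :
    ∃ c : ℚ, ∃ z' ∈ W ⊓ perp {v}, z = c • u + z' :=
  ⟨-symp z v, z + symp z v • u,
    ⟨W.add_mem hz (W.smul_mem _ hu), add_smul_mem_perp_singleton huv z⟩, by module⟩

theorem wedge3_eq_sup (huv : symp u v = -1) (hu : u ∈ W) :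
    wedge3 W = uWedge2 u W ⊔ wedge3 (W ⊓ perp {v}) := by
  refine le_antisymm (Submodule.span_le.2 ?_)
    (sup_le (uWedge2_le_wedge3 hu) (wedge3_mono inf_le_left))
  rintro _ ⟨x, hx, y, hy, z, hz, rfl⟩
  obtain ⟨a, x', hx', rfl⟩ := exists_smul_add huv hu hx
  obtain ⟨b, y', hy', rfl⟩ := exists_smul_add huv hu hy
  obtain ⟨c, z', hz', rfl⟩ := exists_smul_add huv hu hz
  have hxu : ExteriorAlgebra.ι ℚ x' * ExteriorAlgebra.ι ℚ u =
    -(ExteriorAlgebra.ι ℚ u * ExteriorAlgebra.ι ℚ x') := ι_mul_ι_comm _ _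
  have hyu : ExteriorAlgebra.ι ℚ y' * ExteriorAlgebra.ι ℚ u =
    -(ExteriorAlgebra.ι ℚ u * ExteriorAlgebra.ι ℚ y') := ι_mul_ι_comm _ _
  refine Submodule.mem_sup.2
    ⟨a • (ExteriorAlgebra.ι ℚ u * ExteriorAlgebra.ι ℚ (b • u + y') *
          ExteriorAlgebra.ι ℚ (c • u + z')) -
        b • (ExteriorAlgebra.ι ℚ u * ExteriorAlgebra.ι ℚ x' *
          ExteriorAlgebra.ι ℚ (c • u + z')) +
        c • (ExteriorAlgebra.ι ℚ u * ExteriorAlgebra.ι ℚ x' * ExteriorAlgebra.ι ℚ y'),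
      add_mem (sub_mem (Submodule.smul_mem _ _ (wedge_mem_uWedge2 hy hz))
        (Submodule.smul_mem _ _ (wedge_mem_uWedge2 hx'.1 hz)))
        (Submodule.smul_mem _ _ (wedge_mem_uWedge2 hx'.1 hy'.1)),
      _, wedge_mem_wedge3 hx' hy' hz', ?_⟩
  have hxyu : ExteriorAlgebra.ι ℚ x' * ExteriorAlgebra.ι ℚ y' * ExteriorAlgebra.ι ℚ u =
      ExteriorAlgebra.ι ℚ u * ExteriorAlgebra.ι ℚ x' * ExteriorAlgebra.ι ℚ y' := by
    rw [mul_assoc, hyu, mul_neg, ← mul_assoc, hxu, neg_mul, neg_neg]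
  simp only [map_add, map_smul, add_mul, mul_add, smul_mul_assoc, mul_smul_comm, hxyu, hxu,
    neg_mul, smul_add, smul_neg]
  module

theorem uWedge2_eq_sup (hu'v : symp u' v = -1) (hu' : u' ∈ W) :
    uWedge2 u W = uuWedge1 u u' W ⊔ uWedge2 u (W ⊓ perp {v}) := by
  refine le_antisymm (Submodule.span_le.2 ?_)
    (sup_le (uuWedge1_le_uWedge2 hu') (uWedge2_mono inf_le_left))
  rintro _ ⟨y, hy, z, hz, rfl⟩
  obtain ⟨b, y', hy', rfl⟩ := exists_smul_add hu'v hu' hy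
  obtain ⟨c, z', hz', rfl⟩ := exists_smul_add hu'v hu' hz
  have hyu : ExteriorAlgebra.ι ℚ y' * ExteriorAlgebra.ι ℚ u' =
    -(ExteriorAlgebra.ι ℚ u' * ExteriorAlgebra.ι ℚ y') := ι_mul_ι_comm _ _
  refine Submodule.mem_sup.2
    ⟨b • (ExteriorAlgebra.ι ℚ u * ExteriorAlgebra.ι ℚ u' * ExteriorAlgebra.ι ℚ (c • u' + z')) -
        c • (ExteriorAlgebra.ι ℚ u * ExteriorAlgebra.ι ℚ u' * ExteriorAlgebra.ι ℚ y'),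
      sub_mem (Submodule.smul_mem _ _ (wedge_mem_uuWedge1 hz))
        (Submodule.smul_mem _ _ (wedge_mem_uuWedge1 hy'.1)),
      _, wedge_mem_uWedge2 hy' hz', ?_⟩
  simp only [map_add, map_smul, mul_assoc, add_mul, mul_add, smul_mul_assoc, mul_smul_comm, hyu,
    mul_neg, smul_add, smul_neg]
  module

theorem uuWedge1_eq_sup {t : Fin (2 * g) → ℚ} (hv : symp t v = -1) (ht : t ∈ W) :
    uuWedge1 u u' W =
      Submodule.span ℚ
        {ExteriorAlgebra.ι ℚ u * ExteriorAlgebra.ι ℚ u' * ExteriorAlgebra.ι ℚ t} ⊔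
      uuWedge1 u u' (W ⊓ perp {v}) := by
  refine le_antisymm (Submodule.span_le.2 ?_) (sup_le ?_ (uuWedge1_mono inf_le_left))
  · rintro _ ⟨z, hz, rfl⟩
    obtain ⟨c, z', hz', rfl⟩ := exists_smul_add hv ht hz
    rw [map_add, map_smul, mul_add, mul_smul_comm]
    exact Submodule.add_mem_sup (Submodule.smul_mem _ _ (Submodule.mem_span_singleton_self _))
      (wedge_mem_uuWedge1 hz')
  · exact (Submodule.span_singleton_le_iff_mem _ _).2 (wedge_mem_uuWedge1 ht)

theorem span_wedge_le_uWedge2_last {u₁ u₂ u₃ : Fin (2 * g) → ℚ} (h₁ : u₁ ∈ W) (h₂ : u₂ ∈ W) :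
    Submodule.span ℚ
      {ExteriorAlgebra.ι ℚ u₁ * ExteriorAlgebra.ι ℚ u₂ * ExteriorAlgebra.ι ℚ u₃} ≤
      uWedge2 u₃ W := by
  rw [Submodule.span_singleton_le_iff_mem, mul_assoc, ι_mul_ι_comm u₂, mul_neg, ← mul_assoc,
    ι_mul_ι_comm u₁, neg_mul, neg_neg]
  exact wedge_mem_uWedge2 h₁ h₂

end Wedges

/-- Lemma 3.8 — decompositions of the remaining summands. -/
theorem stmt12 (g : ℕ) (U : Submodule ℚ (Fin (2 * g) → ℚ))
    (w : Fin 4 → Fin (2 * g) → ℚ) (u : Fin 3 → Fin (2 * g) → ℚ)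
    (hwU : ∀ i, w i ∈ perp (U : Set (Fin (2 * g) → ℚ)))
    (huU : ∀ i, u i ∈ perp (U : Set (Fin (2 * g) → ℚ)))
    (hworth : ∀ i j, i ≠ j → symp (w i) (w j) = 0)
    (huorth : ∀ i j, i ≠ j → symp (u i) (u j) = 0)
    (hdual : ∀ (i : Fin 4) (j : Fin 3), symp (w i) (u j) = if (i : ℕ) = (j : ℕ) then 1 else 0) :
    let P := perp (U : Set (Fin (2 * g) → ℚ))
    (wedge3 (P ⊓ perp {w 1}) =
        uWedge2 (u 0) (P ⊓ perp {w 1}) ⊔ wedge3 (P ⊓ perp {w 0} ⊓ perp {w 1}) ∧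
      ∀ a ∈ uWedge2 (u 0) (P ⊓ perp {w 1}), ∀ b ∈ wedge3 (P ⊓ perp {w 0} ⊓ perp {w 1}),
        a + b = 0 → a = 0 ∧ b = 0) ∧
    (wedge3 (P ⊓ perp {w 2}) =
        uuWedge1 (u 0) (u 1) (P ⊓ perp {w 2}) ⊔ wedge3 (P ⊓ perp {w 0} ⊓ perp {w 2}) ⊔
          uWedge2 (u 0) (P ⊓ perp {w 1} ⊓ perp {w 2}) ∧
      ∀ a ∈ uuWedge1 (u 0) (u 1) (P ⊓ perp {w 2}),
        ∀ b ∈ wedge3 (P ⊓ perp {w 0} ⊓ perp {w 2}),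
          ∀ c ∈ uWedge2 (u 0) (P ⊓ perp {w 1} ⊓ perp {w 2}),
            a + b + c = 0 → a = 0 ∧ b = 0 ∧ c = 0) ∧
    (wedge3 (P ⊓ perp {w 3}) =
        Submodule.span ℚ
            {ExteriorAlgebra.ι ℚ (u 0) * ExteriorAlgebra.ι ℚ (u 1) * ExteriorAlgebra.ι ℚ (u 2)} ⊔
          wedge3 (P ⊓ perp {w 0} ⊓ perp {w 3}) ⊔
          uWedge2 (u 0) (P ⊓ perp {w 1} ⊓ perp {w 3}) ⊔
          uuWedge1 (u 0) (u 1) (P ⊓ perp {w 2} ⊓ perp {w 3}) ∧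
      ∀ a ∈ Submodule.span ℚ
          {ExteriorAlgebra.ι ℚ (u 0) * ExteriorAlgebra.ι ℚ (u 1) * ExteriorAlgebra.ι ℚ (u 2)},
        ∀ b ∈ wedge3 (P ⊓ perp {w 0} ⊓ perp {w 3}),
          ∀ c ∈ uWedge2 (u 0) (P ⊓ perp {w 1} ⊓ perp {w 3}),
            ∀ d ∈ uuWedge1 (u 0) (u 1) (P ⊓ perp {w 2} ⊓ perp {w 3}),
              a + b + c + d = 0 → a = 0 ∧ b = 0 ∧ c = 0 ∧ d = 0) := by
  intro P
  have hself (i : Fin 4) (j : Fin 3) (h : (i : ℕ) = j) : symp (u j) (w i) = -1 := by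
    rw [symp_swap, hdual, if_pos h]
  have hperp (i : Fin 4) (j : Fin 3) (h : (i : ℕ) ≠ j) : u j ∈ perp {w i} := by
    rw [mem_perp_singleton, symp_swap, hdual, if_neg h, neg_zero]
  have h0 : symp (u 0) (w 0) = -1 := hself 0 0 rfl
  have h1 : symp (u 1) (w 1) = -1 := hself 1 1 rfl
  have h2 : symp (u 2) (w 2) = -1 := hself 2 2 rfl
  have h01 : u 0 ∈ perp {w 1} := hperp 1 0 (by decide)
  have h02 : u 0 ∈ perp {w 2} := hperp 2 0 (by decide)
  have h12 : u 1 ∈ perp {w 2} := hperp 2 1 (by decide)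
  have hmem (i : Fin 4) (j : Fin 3) (h : (i : ℕ) ≠ j) : u j ∈ P ⊓ perp {w i} :=
    ⟨huU j, hperp i j h⟩
  have hright (i j : Fin 4) : P ⊓ perp {w i} ⊓ perp {w j} ≤ perp {w i} :=
    inf_le_left.trans inf_le_right
  refine ⟨⟨?_, ?_⟩, ⟨?_, ?_⟩, ?_, ?_⟩
  · rw [wedge3_eq_sup h0 (hmem 1 0 (by decide)), inf_right_comm]
  · intro a ha b hb hab
    exact eq_zero_of_uWedge2_add_wedge3 h0 ha (wedge3_mono (hright 0 1) hb) hab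
  · rw [wedge3_eq_sup h0 (hmem 2 0 (by decide)),
      uWedge2_eq_sup h1 (hmem 2 1 (by decide)), inf_right_comm P (perp {w 2}) (perp {w 0}),
      inf_right_comm P (perp {w 2}) (perp {w 1}), sup_right_comm]
  · intro a ha b hb c hc habc
    have ha' := uuWedge1_mono le_top ha
    obtain ⟨hac, rfl⟩ := eq_zero_of_uWedge2_add_wedge3 h0
      (add_mem (uuWedge1_le_uWedge2 Submodule.mem_top ha') (uWedge2_mono le_top hc))
      (wedge3_mono (hright 0 2) hb) (by rw [← habc]; abel)
    obtain ⟨rfl, rfl⟩ := eq_zero_of_uWedge2_add_wedge3 h1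
      (uuWedge1_le_uWedge2_right Submodule.mem_top ha')
      (uWedge2_le_wedge3 h01 (uWedge2_mono (hright 1 2) hc)) hac
    exact ⟨rfl, rfl, rfl⟩
  · rw [wedge3_eq_sup h0 (hmem 3 0 (by decide)),
      uWedge2_eq_sup h1 (hmem 3 1 (by decide)),
      uuWedge1_eq_sup h2 (hmem 3 2 (by decide)), inf_right_comm P (perp {w 3}) (perp {w 0}),
      inf_right_comm P (perp {w 3}) (perp {w 1}), inf_right_comm P (perp {w 3}) (perp {w 2})]
    ac_rfl
  · intro a ha b hb c hc d hd habcd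
    have ha' := (Submodule.span_singleton_le_iff_mem _ _).2
      (wedge_mem_uuWedge1 (u := u 0) (u' := u 1) (Submodule.mem_top (x := u 2))) ha
    have hd' := uuWedge1_mono le_top hd
    obtain ⟨hacd, rfl⟩ := eq_zero_of_uWedge2_add_wedge3 h0
      (add_mem (uuWedge1_le_uWedge2 Submodule.mem_top (add_mem ha' hd'))
        (uWedge2_mono le_top hc))
      (wedge3_mono (hright 0 3) hb) (by rw [← habcd]; abel)
    obtain ⟨had, rfl⟩ := eq_zero_of_uWedge2_add_wedge3 h1
      (uuWedge1_le_uWedge2_right Submodule.mem_top (add_mem ha' hd'))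
      (uWedge2_le_wedge3 h01 (uWedge2_mono (hright 1 3) hc)) hacd
    obtain ⟨rfl, rfl⟩ := eq_zero_of_uWedge2_add_wedge3 h2
      (span_wedge_le_uWedge2_last Submodule.mem_top Submodule.mem_top ha)
      (uWedge2_le_wedge3 h02 (uuWedge1_le_uWedge2 h12 (uuWedge1_mono (hright 2 3) hd))) had
    exact ⟨rfl, rfl, rfl, rfl⟩

end Paper
end
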